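/- Let Ω ⊂ ℝⁿ be a bounded John domain, β ≥ 0, and 1 < q < ∞. Then the Hardy-type operator T is continuous from L^q(Ω, ρ^{−β}) to itself, and its operator norm satisfies ‖T‖ ≤ C K^β, where C is a constant independent of Ω and K is the geometric constant of the tree structure (i.e., the constant with Q_s ⊆ K Q_t for all s ⪰ t). -/

import Mathlib

open MeasureTheory Metric Set Matrix
open scoped BigOperators ENNReal

noncomputable section

abbrev Euc (n : ℕ) := EuclideanSpace ℝ (Fin n)

/-- Differential matrix `(Dv)_{ij} = ∂v_i/∂x_j` (computed via the Fréchet derivative). -/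
def Dmat {n : ℕ} (v : Euc n → Euc n) (x : Euc n) : Matrix (Fin n) (Fin n) ℝ :=
  fun i j => fderiv ℝ v x (EuclideanSpace.single j 1) i

/-- Symmetric part of the differential matrix. -/
def epsMat {n : ℕ} (v : Euc n → Euc n) (x : Euc n) : Matrix (Fin n) (Fin n) ℝ :=
  (1 / 2 : ℝ) • (Dmat v x + (Dmat v x)ᵀ)

/-- Trace-free part of the symmetric part of the differential matrix. -/
def lMat {n : ℕ} (v : Euc n → Euc n) (x : Euc n) : Matrix (Fin n) (Fin n) ℝ :=
  epsMat v x - (Matrix.trace (Dmat v x) / (n : ℝ)) • (1 : Matrix (Fin n) (Fin n) ℝ)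

/-- Frobenius (Euclidean) norm of a matrix. -/
def matNorm {n : ℕ} (M : Matrix (Fin n) (Fin n) ℝ) : ℝ :=
  Real.sqrt (∑ i, ∑ j, (M i j) ^ 2)

/-- `M : N = Σ_{ij} M_{ij} N_{ij}`. -/
def matDot {n : ℕ} (M N : Matrix (Fin n) (Fin n) ℝ) : ℝ := ∑ i, ∑ j, M i j * N i j

/-- Distance to the boundary of `Ω`. -/
def distBd {n : ℕ} (Ω : Set (Euc n)) (x : Euc n) : ℝ := Metric.infDist x (frontier Ω)

/-- Open axis-parallel cube with center `c` and side length `h`. -/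
def openCube {n : ℕ} (c : Euc n) (h : ℝ) : Set (Euc n) := {x | ∀ i, |x i - c i| < h / 2}

/-- Closed axis-parallel cube with center `c` and side length `h`. -/
def closedCube {n : ℕ} (c : Euc n) (h : ℝ) : Set (Euc n) := {x | ∀ i, |x i - c i| ≤ h / 2}

/-- Bounded John domain: there are `C > 1` and a distinguished point `x₀ ∈ Ω` such that
every point of `Ω` is joined to `x₀` by a rectifiable curve, parameterized by arc length
(hence 1-Lipschitz), along which the distance to the boundary grows linearly. -/
def IsJohnDomain {n : ℕ} (Ω : Set (Euc n)) : Prop :=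
  ∃ C > (1 : ℝ), ∃ x₀ ∈ Ω, ∀ y ∈ Ω, ∃ L : ℝ, 0 ≤ L ∧ ∃ γ : ℝ → Euc n,
    γ 0 = y ∧ γ L = x₀ ∧ (∀ t ∈ Icc 0 L, γ t ∈ Ω) ∧
    (∀ s ∈ Icc 0 L, ∀ t ∈ Icc 0 L, dist (γ s) (γ t) ≤ |s - t|) ∧
    (∀ t ∈ Icc 0 L, t / C ≤ Metric.infDist (γ t) (frontier Ω))

/-- The matrix-valued functions `H_i`. -/
def Hmat {n : ℕ} (i : Fin n) (z : Euc n) : Matrix (Fin n) (Fin n) ℝ :=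
  fun j k => if j = k then z i else if k = i then z j else if j = i then -z k else 0

/-- The finite-dimensional space `V = D(Σ)`:
`φ(x) = A + λ I + Σ_i b_i H_i(x − y)` with `A` skew-symmetric. -/
def Vset (n : ℕ) : Set (Euc n → Matrix (Fin n) (Fin n) ℝ) :=
  {φ | ∃ (A : Matrix (Fin n) (Fin n) ℝ) (lam : ℝ) (b : Fin n → ℝ) (y : Euc n),
    Aᵀ = -A ∧ ∀ x, φ x = A + lam • (1 : Matrix (Fin n) (Fin n) ℝ) + ∑ i, b i • Hmat i (x - y)}


/-- A Whitney decomposition of `Ω`: closed dyadic axis-parallel cubes `Q_t` with pairwise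
disjoint interiors covering `Ω`, with `diam(Q_t) ≤ dist(Q_t, ∂Ω) ≤ 4 diam(Q_t)` and
comparable diameters (within a factor 4) for touching cubes. -/
structure WhitneyDecomp (n : ℕ) (Ω : Set (Euc n)) (Γ : Type) where
  c : Γ → Euc n
  s : Γ → ℝ
  s_pos : ∀ t, 0 < s t
  dyadic : ∀ t, ∃ k : ℤ, s t = (2 : ℝ) ^ k ∧
    ∀ i, ∃ m : ℤ, c t i = (m : ℝ) * (2 : ℝ) ^ k + (2 : ℝ) ^ k / 2
  interior_disj : Pairwise fun t t' =>
    interior (closedCube (c t) (s t)) ∩ interior (closedCube (c t') (s t')) = ∅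
  cover : (⋃ t, closedCube (c t) (s t)) = Ω
  diam_le_dist : ∀ t, ∀ x ∈ closedCube (c t) (s t),
    Metric.diam (closedCube (c t) (s t)) ≤ Metric.infDist x (frontier Ω)
  dist_le_diam : ∀ t, ∃ x ∈ closedCube (c t) (s t),
    Metric.infDist x (frontier Ω) ≤ 4 * Metric.diam (closedCube (c t) (s t))
  nbr_comparable : ∀ t t', (closedCube (c t) (s t) ∩ closedCube (c t') (s t')).Nonempty →
    Metric.diam (closedCube (c t) (s t)) ≤ 4 * Metric.diam (closedCube (c t') (s t'))

/-- The extended (open) Whitney cube `Ω_t = (9/8) Q_t°`. -/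
def extCube {n : ℕ} {Ω : Set (Euc n)} {Γ : Type} (wd : WhitneyDecomp n Ω Γ) (t : Γ) :
    Set (Euc n) :=
  openCube (wd.c t) (9 / 8 * wd.s t)

/-- A closed `(n−1)`-dimensional face of the cube with center `c` and side `h`. -/
def cubeFace {n : ℕ} (c : Euc n) (h : ℝ) (i : Fin n) (σ : Bool) : Set (Euc n) :=
  {x ∈ closedCube c h | x i = c i + (if σ then h / 2 else -(h / 2))}

/-- Two axis-parallel cubes are `(n−1)`-neighbors when their intersection is an
`(n−1)`-dimensional face of one of them. -/
def IsFaceNeighbor {n : ℕ} (c₁ : Euc n) (h₁ : ℝ) (c₂ : Euc n) (h₂ : ℝ) : Prop :=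
  ∃ i σ, closedCube c₁ h₁ ∩ closedCube c₂ h₂ = cubeFace c₁ h₁ i σ ∨
    closedCube c₁ h₁ ∩ closedCube c₂ h₂ = cubeFace c₂ h₂ i σ

/-- A tree structure on the index set `Γ` of a Whitney decomposition: a root and a parent
map reaching the root in finitely many steps, whose edges join `(n−1)`-neighbor cubes. -/
structure TreeStruct {n : ℕ} {Ω : Set (Euc n)} {Γ : Type} (wd : WhitneyDecomp n Ω Γ) where
  root : Γ
  parent : Γ → Γ
  parent_root : parent root = root
  reaches_root : ∀ t, ∃ k : ℕ, parent^[k] t = root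
  parent_nbr : ∀ t, t ≠ root →
    IsFaceNeighbor (wd.c t) (wd.s t) (wd.c (parent t)) (wd.s (parent t))

/-- The induced partial order: `s ⪯ t` iff the path from `t` to the root passes
through `s`, i.e. `s` is obtained from `t` by iterating the parent map. -/
def treeLE {n : ℕ} {Ω : Set (Euc n)} {Γ : Type} {wd : WhitneyDecomp n Ω Γ}
    (T : TreeStruct wd) (s t : Γ) : Prop :=
  ∃ k : ℕ, T.parent^[k] t = s

/-- The shadow `W_t = ⋃_{s ⪰ t} Ω_s` of the extended cube `Ω_t`. -/
def shadow {n : ℕ} {Ω : Set (Euc n)} {Γ : Type} {wd : WhitneyDecomp n Ω Γ}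
    (T : TreeStruct wd) (t : Γ) : Set (Euc n) :=
  ⋃ (s : Γ) (_ : treeLE T t s), extCube wd s

open Classical in
/-- The Hardy type operator `Tg(x) = Σ_{t ≠ a} (χ_{B_t}(x)/|W_t|) ∫_{W_t} |g|`, for a
family of cubes `B_t = openCube (Bc t) (Bh t)`. -/
def hardyT {n : ℕ} {Ω : Set (Euc n)} {Γ : Type} {wd : WhitneyDecomp n Ω Γ}
    (T : TreeStruct wd) (Bc : Γ → Euc n) (Bh : Γ → ℝ) (u : Euc n → ℝ) (x : Euc n) : ℝ :=
  ∑ᶠ t : Γ, if t = T.root then 0 else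
    Set.indicator (openCube (Bc t) (Bh t))
      (fun _ => (∫ y in shadow T t, |u y|) / (volume (shadow T t)).toReal) x

lemma ENNReal.mul_rpow_mul_le_rpow_add {q : ℝ} (hq : 1 < q) (x : ℝ≥0∞) {a : ℝ≥0∞} (ha : a ≠ ⊤) :
    ENNReal.ofReal q * a ^ (q - 1) * x ≤ x ^ q + ENNReal.ofReal (q - 1) * a ^ q := by
  have hq0 : 0 < q := by linarith
  rcases eq_or_ne x ⊤ with rfl | hx
  · simp [ENNReal.top_rpow_of_pos hq0]
  lift a to NNReal using ha
  lift x to NNReal using hx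
  rw [← ENNReal.coe_rpow_of_nonneg _ (by linarith), ← ENNReal.coe_rpow_of_nonneg _ hq0.le,
    ← ENNReal.coe_rpow_of_nonneg _ hq0.le, ENNReal.ofReal, ENNReal.ofReal]
  norm_cast
  rw [← NNReal.coe_le_coe]
  push_cast
  rw [Real.coe_toNNReal _ hq0.le, Real.coe_toNNReal _ (by linarith)]
  have hc : q.HolderConjugate (q / (q - 1)) := Real.HolderConjugate.conjExponent hq
  have h := Real.young_inequality_of_nonneg x.2 (Real.rpow_nonneg a.2 (q - 1)) hc
  rw [← Real.rpow_mul a.2, mul_div_cancel₀ _ (by linarith : q - 1 ≠ 0)] at h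
  have h2 := mul_le_mul_of_nonneg_left h hq0.le
  have h3 : q * ((x : ℝ) ^ q / q + (a : ℝ) ^ q / (q / (q - 1))) = x ^ q + (q - 1) * a ^ q := by
    field_simp
  calc q * (a : ℝ) ^ (q - 1) * x = q * (x * (a : ℝ) ^ (q - 1)) := by ring
    _ ≤ _ := h2
    _ = _ := h3

lemma ENNReal.mul_rpow_mul_le_add_rpow {q κ : ℝ} (hq : 1 < q) (hκ : 0 < κ)
    (x : ℝ≥0∞) {a : ℝ≥0∞} (ha : a ≠ ⊤) :
    ENNReal.ofReal q * a ^ (q - 1) * x ≤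
      ENNReal.ofReal κ * a ^ q + ENNReal.ofReal (q * (q / κ) ^ (q - 1)) * x ^ q := by
  have hq0 : 0 < q := by linarith
  have hC : 0 < q * (q / κ) ^ (q - 1) := by positivity
  rcases eq_or_ne x ⊤ with rfl | hx
  · rw [ENNReal.top_rpow_of_pos hq0, ENNReal.mul_top ((ENNReal.ofReal_pos.2 hC).ne')]
    simp
  lift a to NNReal using ha
  lift x to NNReal using hx
  rw [← ENNReal.coe_rpow_of_nonneg _ (by linarith), ← ENNReal.coe_rpow_of_nonneg _ hq0.le,
    ← ENNReal.coe_rpow_of_nonneg _ hq0.le, ENNReal.ofReal, ENNReal.ofReal, ENNReal.ofReal]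
  norm_cast
  rw [← NNReal.coe_le_coe]
  push_cast
  rw [Real.coe_toNNReal _ hq0.le, Real.coe_toNNReal _ hκ.le, Real.coe_toNNReal _ hC.le]
  have split : ∀ y : ℝ, 0 ≤ y → y ^ q = y ^ (q - 1) * y := fun y hy => by
    rw [← Real.rpow_add_one' hy (by linarith)]; congr 1; ring
  have ha0 := a.coe_nonneg
  have hx0 := x.coe_nonneg
  generalize (a : ℝ) = a at *
  generalize (x : ℝ) = x at *
  rcases le_total (q * x) (κ * a) with h | h
  · have h1 : q * a ^ (q - 1) * x ≤ κ * a ^ q := by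
      rw [split a ha0]
      calc q * a ^ (q - 1) * x = a ^ (q - 1) * (q * x) := by ring
        _ ≤ a ^ (q - 1) * (κ * a) := by gcongr
        _ = _ := by ring
    have : 0 ≤ q * (q / κ) ^ (q - 1) * x ^ q := by positivity
    linarith
  · have h0 : a ≤ q / κ * x := by
      rw [div_mul_eq_mul_div, le_div_iff₀ hκ]; linarith
    have h1 : a ^ (q - 1) ≤ (q / κ) ^ (q - 1) * x ^ (q - 1) := by
      rw [← Real.mul_rpow (by positivity) hx0]
      exact Real.rpow_le_rpow ha0 h0 (by linarith)
    have h2 : q * a ^ (q - 1) * x ≤ q * (q / κ) ^ (q - 1) * x ^ q := by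
      rw [split x hx0]
      calc q * a ^ (q - 1) * x ≤ q * ((q / κ) ^ (q - 1) * x ^ (q - 1)) * x := by gcongr
        _ = _ := by ring
    have : 0 ≤ κ * a ^ q := by positivity
    linarith

lemma ENNReal.rpow_eq_rpow_sub_one_mul {q : ℝ} (hq : 1 < q) (a : ℝ≥0∞) :
    a ^ q = a ^ (q - 1) * a := by
  conv_lhs => rw [show q = (q - 1) + 1 by ring,
    ENNReal.rpow_add_of_nonneg _ _ (by linarith) zero_le_one, ENNReal.rpow_one]

/-- Summed tangent line inequality for `x ↦ x ^ q` at `a`. -/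
lemma ENNReal.mul_rpow_mul_tsum_le {ι : Type*} {q : ℝ} (hq : 1 < q) (M A : ι → ℝ≥0∞)
    {a : ℝ≥0∞} (ha : a ≠ ⊤) :
    ENNReal.ofReal q * a ^ (q - 1) * ∑' i, M i * A i ≤
      ∑' i, M i * A i ^ q + ENNReal.ofReal (q - 1) * a ^ q * ∑' i, M i := by
  rw [← ENNReal.tsum_mul_left, ← ENNReal.tsum_mul_left, ← ENNReal.tsum_add]
  refine ENNReal.tsum_le_tsum fun i => ?_
  calc _ = M i * (ENNReal.ofReal q * a ^ (q - 1) * A i) := by ring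
    _ ≤ M i * (A i ^ q + ENNReal.ofReal (q - 1) * a ^ q) := by
      gcongr; exact ENNReal.mul_rpow_mul_le_rpow_add hq _ ha
    _ = _ := by ring

lemma ENNReal.ofReal_eq_one_add {q : ℝ} (hq : 1 < q) :
    ENNReal.ofReal q = 1 + ENNReal.ofReal (q - 1) := by
  rw [← ENNReal.ofReal_one, ← ENNReal.ofReal_add zero_le_one (by linarith)]; congr 1; ring

/-- One step of the Bellman function argument for averages along a tree. -/
lemma ENNReal.average_step {ι : Type*} {q : ℝ} (hq : 1 < q) (M A : ι → ℝ≥0∞)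
    {m g a : ℝ≥0∞} (ha : a ≠ ⊤) (hm : m ≠ ⊤) (hM : ∑' i, M i ≠ ⊤)
    (haM : a * (m + ∑' i, M i) = m * g + ∑' i, M i * A i) :
    ENNReal.ofReal ((q - 1) / 2) * (m * a ^ q) + (m + ∑' i, M i) * a ^ q ≤
      ENNReal.ofReal (q * (q / ((q - 1) / 2)) ^ (q - 1)) * (m * g ^ q)
        + ∑' i, M i * A i ^ q := by
  have haq : a ^ q ≠ ⊤ := ENNReal.rpow_ne_top_of_nonneg (by linarith) ha
  have h1 := ENNReal.mul_rpow_mul_tsum_le hq M A ha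
  have h2 := ENNReal.mul_rpow_mul_le_add_rpow hq (half_pos (sub_pos.2 hq)) g ha
  set κ := ENNReal.ofReal ((q - 1) / 2) with hκ
  set C := ENNReal.ofReal (q * (q / ((q - 1) / 2)) ^ (q - 1))
  have hκq : ENNReal.ofReal (q - 1) = κ + κ := by
    rw [hκ, ← ENNReal.ofReal_add (by linarith) (by linarith)]; congr 1; ring
  have hq' := ENNReal.ofReal_eq_one_add hq
  have key : ENNReal.ofReal q * a ^ q * (m + ∑' i, M i) ≤
      m * (κ * a ^ q + C * g ^ q) +
        (∑' i, M i * A i ^ q + ENNReal.ofReal (q - 1) * a ^ q * ∑' i, M i) := by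
    calc _ = ENNReal.ofReal q * a ^ (q - 1) * (a * (m + ∑' i, M i)) := by
          rw [ENNReal.rpow_eq_rpow_sub_one_mul hq]; ring
      _ = m * (ENNReal.ofReal q * a ^ (q - 1) * g)
          + ENNReal.ofReal q * a ^ (q - 1) * ∑' i, M i * A i := by rw [haM]; ring
      _ ≤ _ := by gcongr
  have hfin : m * (κ * a ^ q) + ENNReal.ofReal (q - 1) * a ^ q * ∑' i, M i ≠ ⊤ := by
    refine ENNReal.add_ne_top.2 ⟨?_, ?_⟩ <;> finiteness
  refine (ENNReal.add_le_add_iff_right hfin).1 ?_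
  calc _ = ENNReal.ofReal q * a ^ q * (m + ∑' i, M i) := by
        rw [hq', hκq]; ring
    _ ≤ _ := key
    _ = _ := by ring

/-- Jensen's inequality for a weighted average. -/
lemma ENNReal.tsum_mul_average_rpow_le {ι : Type*} {q : ℝ} (hq : 1 < q) (m g : ι → ℝ≥0∞)
    {a : ℝ≥0∞} (ha : a ≠ ⊤) (hm : ∑' i, m i ≠ ⊤)
    (haM : a * ∑' i, m i = ∑' i, m i * g i) :
    (∑' i, m i) * a ^ q ≤ ∑' i, m i * g i ^ q := by
  have haq : a ^ q ≠ ⊤ := ENNReal.rpow_ne_top_of_nonneg (by linarith) ha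
  have h1 := ENNReal.mul_rpow_mul_tsum_le hq m g ha
  have hfin : ENNReal.ofReal (q - 1) * a ^ q * ∑' i, m i ≠ ⊤ := by finiteness
  refine (ENNReal.add_le_add_iff_right hfin).1 (le_trans (le_of_eq ?_) h1)
  rw [← haM, ENNReal.ofReal_eq_one_add hq, ENNReal.rpow_eq_rpow_sub_one_mul hq]
  ring

open Classical in
/-- Sum of `F` over the descendants of `t` for the parent map `p`. -/
def descSum {Γ : Type*} (p : Γ → Γ) (F : Γ → ℝ≥0∞) (t : Γ) : ℝ≥0∞ :=
  ∑' s, if ∃ k : ℕ, p^[k] s = t then F s else 0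

/-- `d` is a depth function for the parent map `p`, whose fixed points are the roots. -/
structure IsDepth {Γ : Type*} (p : Γ → Γ) (d : Γ → ℕ) : Prop where
  step : ∀ t, d t ≠ 0 → d t = d (p t) + 1
  root : ∀ t, d t = 0 → p t = t

lemma IsDepth.iterate_le {Γ : Type*} {p : Γ → Γ} {d : Γ → ℕ} (h : IsDepth p d) (k : ℕ) (t : Γ) :
    d (p^[k] t) ≤ d t := by
  induction k generalizing t with
  | zero => simp
  | succ k ih =>
    rw [Function.iterate_succ_apply]
    refine (ih _).trans ?_
    by_cases h0 : d t = 0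
    · rw [h.root t h0]
    · have := h.step t h0; omega

lemma IsDepth.iterate_eq_self {Γ : Type*} {p : Γ → Γ} {d : Γ → ℕ} (h : IsDepth p d) {k : ℕ}
    {t : Γ} (hk : d (p^[k] t) = d t) : p^[k] t = t := by
  induction k generalizing t with
  | zero => simp
  | succ k ih =>
    rw [Function.iterate_succ_apply] at hk ⊢
    by_cases h0 : d t = 0
    · rw [h.root t h0] at hk ⊢
      exact ih hk
    · have := h.step t h0
      have := h.iterate_le k (p t)
      omega

lemma IsDepth.iterate_inj {Γ : Type*} {p : Γ → Γ} {d : Γ → ℕ} (h : IsDepth p d) {i j : ℕ}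
    {s : Γ} (hij : d (p^[i] s) = d (p^[j] s)) : p^[i] s = p^[j] s := by
  wlog hle : i ≤ j generalizing i j
  · exact (this hij.symm (by omega)).symm
  obtain ⟨l, rfl⟩ := Nat.exists_eq_add_of_le hle
  rw [add_comm, Function.iterate_add_apply] at hij ⊢
  exact (h.iterate_eq_self hij.symm).symm

lemma IsDepth.exists_child {Γ : Type*} {p : Γ → Γ} {d : Γ → ℕ} (h : IsDepth p d) {s t : Γ}
    (hst : s ≠ t) (hk : ∃ k : ℕ, p^[k] s = t) :
    ∃ c, (d c = d t + 1 ∧ p c = t) ∧ ∃ k : ℕ, p^[k] s = c := by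
  classical
  have hspec := Nat.find_spec hk
  have hmin := fun m => Nat.find_min hk (m := m)
  set k := Nat.find hk
  rcases Nat.eq_zero_or_pos k with h0 | hpos
  · rw [h0] at hspec; exact absurd hspec hst
  obtain ⟨j, hj⟩ := Nat.exists_eq_succ_of_ne_zero hpos.ne'
  rw [hj, Function.iterate_succ_apply'] at hspec
  refine ⟨p^[j] s, ⟨?_, hspec⟩, j, rfl⟩
  by_cases hd0 : d (p^[j] s) = 0
  · rw [h.root _ hd0] at hspec
    exact absurd hspec (hmin j (by omega))
  · rw [h.step _ hd0, hspec]

open Classical in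
lemma descSum_eq_add {Γ : Type*} {p : Γ → Γ} {d : Γ → ℕ} (h : IsDepth p d) (F : Γ → ℝ≥0∞)
    (t : Γ) : descSum p F t =
      F t + ∑' c, if d c = d t + 1 ∧ p c = t then descSum p F c else 0 := by
  have h1 : (∑' c, if d c = d t + 1 ∧ p c = t then descSum p F c else 0) =
      ∑' s, ∑' c, if d c = d t + 1 ∧ p c = t then
        (if ∃ k : ℕ, p^[k] s = c then F s else 0) else 0 := by
    rw [ENNReal.tsum_comm]
    refine tsum_congr fun c => ?_
    split_ifs with hc
    · rfl
    · simp
  have h2 : F t = ∑' s, if s = t then F s else 0 := by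
    rw [tsum_ite_eq]
  rw [h1, h2, ← ENNReal.tsum_add, descSum]
  refine tsum_congr fun s => ?_
  by_cases hst : s = t
  · subst hst
    rw [if_pos ⟨0, rfl⟩, if_pos rfl, ENNReal.tsum_eq_zero.2, add_zero]
    intro c
    split_ifs with hc hk
    · obtain ⟨k, rfl⟩ := hk
      have := h.iterate_le k s
      omega
    · rfl
    · rfl
  rw [if_neg hst, zero_add]
  by_cases hk : ∃ k : ℕ, p^[k] s = t
  · obtain ⟨c, hc, hkc⟩ := h.exists_child hst hk
    rw [if_pos hk, tsum_eq_single c, if_pos hc, if_pos hkc]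
    intro c' hne
    split_ifs with hc' hk'
    · obtain ⟨i, rfl⟩ := hkc
      obtain ⟨j, rfl⟩ := hk'
      exact absurd (h.iterate_inj (by rw [hc'.1, hc.1])) hne
    · rfl
    · rfl
  · rw [if_neg hk, eq_comm, ENNReal.tsum_eq_zero]
    intro c
    split_ifs with hc hk'
    · obtain ⟨k, rfl⟩ := hk'
      exact absurd ⟨k + 1, by rw [Function.iterate_succ_apply', hc.2]⟩ hk
    · rfl
    · rfl

lemma descSum_le_tsum {Γ : Type*} (p : Γ → Γ) (F : Γ → ℝ≥0∞) (t : Γ) :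
    descSum p F t ≤ ∑' s, F s :=
  ENNReal.tsum_le_tsum fun s => by split_ifs <;> simp

lemma le_descSum {Γ : Type*} (p : Γ → Γ) (F : Γ → ℝ≥0∞) (t : Γ) : F t ≤ descSum p F t := by
  classical
  refine le_trans (le_of_eq ?_) (ENNReal.le_tsum t)
  rw [if_pos ⟨0, rfl⟩]

open Classical in
lemma tsum_level_descSum_le {Γ : Type*} {p : Γ → Γ} {d : Γ → ℕ} (h : IsDepth p d)
    (F : Γ → ℝ≥0∞) (k : ℕ) :
    (∑' t, if d t = k then descSum p F t else 0) ≤ ∑' s, F s := by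
  have h1 : (∑' t, if d t = k then descSum p F t else 0) =
      ∑' s, ∑' t, if d t = k then (if ∃ j : ℕ, p^[j] s = t then F s else 0) else 0 := by
    rw [ENNReal.tsum_comm]
    refine tsum_congr fun c => ?_
    split_ifs with hc
    · rfl
    · simp
  rw [h1]
  refine ENNReal.tsum_le_tsum fun s => ?_
  by_cases hs : ∃ j : ℕ, d (p^[j] s) = k
  · obtain ⟨j, hj⟩ := hs
    rw [tsum_eq_single (p^[j] s)]
    · split_ifs <;> simp
    · intro t hne
      split_ifs with ht hi
      · obtain ⟨i, rfl⟩ := hi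
        exact absurd (h.iterate_inj (by rw [ht, hj])) hne
      · rfl
      · rfl
  · rw [ENNReal.tsum_eq_zero.2]
    · exact zero_le
    · intro t
      split_ifs with ht hi
      · obtain ⟨i, rfl⟩ := hi
        exact absurd ⟨i, ht⟩ hs
      · rfl
      · rfl

open Classical in
lemma tsum_level_children {Γ : Type*} {p : Γ → Γ} {d : Γ → ℕ} (h : IsDepth p d)
    (F : Γ → ℝ≥0∞) (k : ℕ) :
    (∑' t, if d t = k then ∑' c, (if d c = d t + 1 ∧ p c = t then F c else 0) else 0) =
      ∑' c, if d c = k + 1 then F c else 0 := by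
  have h1 : (∑' t, if d t = k then ∑' c, (if d c = d t + 1 ∧ p c = t then F c else 0) else 0) =
      ∑' c, ∑' t, if d t = k then (if d c = d t + 1 ∧ p c = t then F c else 0) else 0 := by
    rw [ENNReal.tsum_comm]
    refine tsum_congr fun c => ?_
    split_ifs with hc
    · rfl
    · simp
  rw [h1]
  refine tsum_congr fun c => ?_
  rw [tsum_eq_single (p c)]
  · by_cases hc : d c = k + 1
    · have := h.step c (by omega)
      rw [if_pos (by omega), if_pos ⟨this, rfl⟩, if_pos hc]
    · rw [if_neg hc]
      split_ifs with h1 h2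
      · omega
      · rfl
      · rfl
  · intro t ht
    split_ifs with h1 h2
    · exact absurd h2.2.symm ht
    · rfl
    · rfl

/-- Doob's inequality for averages over descendants in a tree. -/
theorem tsum_mul_descAverage_rpow_le {Γ : Type*} {q : ℝ} (hq : 1 < q) {p : Γ → Γ} {d : Γ → ℕ}
    (h : IsDepth p d) (m g : Γ → ℝ≥0∞) (hm0 : ∀ t, m t ≠ 0) (hm : ∑' t, m t ≠ ⊤)
    (hmg : ∑' t, m t * g t ≠ ⊤) :
    ENNReal.ofReal ((q - 1) / 2) *
        ∑' t, m t * (descSum p (fun s => m s * g s) t / descSum p m t) ^ q ≤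
      (ENNReal.ofReal (q * (q / ((q - 1) / 2)) ^ (q - 1)) + 1) * ∑' t, m t * g t ^ q := by
  classical
  set A : Γ → ℝ≥0∞ := fun t => descSum p (fun s => m s * g s) t / descSum p m t with hA
  set κ := ENNReal.ofReal ((q - 1) / 2)
  set C := ENNReal.ofReal (q * (q / ((q - 1) / 2)) ^ (q - 1))
  have hMtop : ∀ t, descSum p m t ≠ ⊤ := fun t => ne_top_of_le_ne_top hm (descSum_le_tsum p m t)
  have hM0 : ∀ t, descSum p m t ≠ 0 := fun t h0 =>
    hm0 t (le_antisymm (h0 ▸ le_descSum p m t) zero_le)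
  have hGtop : ∀ t, descSum p (fun s => m s * g s) t ≠ ⊤ := fun t =>
    ne_top_of_le_ne_top hmg (descSum_le_tsum p _ t)
  have hAtop : ∀ t, A t ≠ ⊤ := fun t => ENNReal.div_ne_top (hGtop t) (hM0 t)
  have hAM : ∀ t, A t * descSum p m t = descSum p (fun s => m s * g s) t := fun t =>
    ENNReal.div_mul_cancel (hM0 t) (hMtop t)
  have hstep : ∀ t, κ * (m t * A t ^ q) + descSum p m t * A t ^ q ≤ C * (m t * g t ^ q) +
      ∑' c, if d c = d t + 1 ∧ p c = t then descSum p m c * A c ^ q else 0 := by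
    intro t
    have hs := descSum_eq_add h m t
    have key := ENNReal.average_step hq
      (fun c => if d c = d t + 1 ∧ p c = t then descSum p m c else 0) A (m := m t) (g := g t)
      (hAtop t) (ne_top_of_le_ne_top hm (ENNReal.le_tsum t))
      (fun h0 => hMtop t (by rw [hs, h0]; simp))
      (by
        rw [← hs, hAM, descSum_eq_add h]
        congr 1
        refine tsum_congr fun c => ?_
        split_ifs
        · rw [← hAM, mul_comm]
        · simp)
    rw [← hs] at key
    refine key.trans (le_of_eq ?_)
    congr 1
    refine tsum_congr fun c => ?_
    split_ifs <;> simp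
  set f : Γ → ℝ≥0∞ := fun t => m t * A t ^ q
  set b : Γ → ℝ≥0∞ := fun t => m t * g t ^ q
  set Φ : ℕ → ℝ≥0∞ := fun k => ∑' t, if d t = k then descSum p m t * A t ^ q else 0
  have hlevel : ∀ k, κ * (∑' t, if d t = k then f t else 0) + Φ k ≤
      C * (∑' t, if d t = k then b t else 0) + Φ (k + 1) := by
    intro k
    simp only [Φ]
    rw [← tsum_level_children h, ← ENNReal.tsum_mul_left, ← ENNReal.tsum_mul_left,
      ← ENNReal.tsum_add, ← ENNReal.tsum_add]
    refine ENNReal.tsum_le_tsum fun t => ?_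
    split_ifs
    · exact hstep t
    · simp
  have hsplit : ∀ (F : Γ → ℝ≥0∞) (k : ℕ), (∑' t, if d t < k + 1 then F t else 0) =
      (∑' t, if d t < k then F t else 0) + ∑' t, if d t = k then F t else 0 := by
    intro F k
    rw [← ENNReal.tsum_add]
    refine tsum_congr fun t => ?_
    rcases lt_trichotomy (d t) k with h1 | h1 | h1
    · rw [if_pos (by omega), if_pos h1, if_neg (by omega), add_zero]
    · rw [if_pos (by omega), if_neg (by omega), if_pos h1, zero_add]
    · rw [if_neg (by omega), if_neg (by omega), if_neg (by omega), add_zero]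
  have hpartial : ∀ k, κ * (∑' t, if d t < k then f t else 0) + Φ 0 ≤
      C * (∑' t, if d t < k then b t else 0) + Φ k := by
    intro k
    induction k with
    | zero => simp
    | succ k ih =>
      rw [hsplit, hsplit]
      calc _ = (κ * (∑' t, if d t < k then f t else 0) + Φ 0) +
            κ * (∑' t, if d t = k then f t else 0) := by ring
        _ ≤ (C * (∑' t, if d t < k then b t else 0) + Φ k) +
            κ * (∑' t, if d t = k then f t else 0) := by gcongr
        _ = C * (∑' t, if d t < k then b t else 0) +
            (κ * (∑' t, if d t = k then f t else 0) + Φ k) := by ring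
        _ ≤ C * (∑' t, if d t < k then b t else 0) +
            (C * (∑' t, if d t = k then b t else 0) + Φ (k + 1)) := by
          exact add_le_add le_rfl (hlevel k)
        _ = _ := by ring
  have hΦ : ∀ k, Φ k ≤ ∑' t, b t := by
    intro k
    refine le_trans (ENNReal.tsum_le_tsum fun t => ?_) (tsum_level_descSum_le h b k)
    split_ifs
    · have hj := ENNReal.tsum_mul_average_rpow_le hq
        (fun s => if ∃ k : ℕ, p^[k] s = t then m s else 0) g (hAtop t) (hMtop t)
        (by
          refine (hAM t).trans (tsum_congr fun s => ?_)
          split_ifs <;> simp)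
      refine hj.trans (le_of_eq (tsum_congr fun s => ?_))
      split_ifs <;> simp [b]
    · exact le_rfl
  rw [← ENNReal.tsum_mul_left, ENNReal.tsum_eq_iSup_sum]
  refine iSup_le fun S => ?_
  obtain ⟨k, hk⟩ : ∃ k, ∀ t ∈ S, d t < k :=
    ⟨S.sup d + 1, fun t ht => Nat.lt_succ_of_le (Finset.le_sup ht)⟩
  calc ∑ t ∈ S, κ * f t = κ * ∑ t ∈ S, if d t < k then f t else 0 := by
        rw [Finset.mul_sum]
        exact Finset.sum_congr rfl fun t ht => by rw [if_pos (hk t ht)]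
    _ ≤ κ * ∑' t, if d t < k then f t else 0 := by gcongr; exact ENNReal.sum_le_tsum S
    _ ≤ κ * (∑' t, if d t < k then f t else 0) + Φ 0 := le_self_add
    _ ≤ C * (∑' t, if d t < k then b t else 0) + Φ k := hpartial k
    _ ≤ C * (∑' t, b t) + ∑' t, b t := by
        gcongr
        · split_ifs <;> simp
        · exact hΦ k
    _ = _ := by ring

lemma openCube_eq_preimage {n : ℕ} (c : Euc n) (h : ℝ) :
    openCube c h =
      WithLp.ofLp ⁻¹' (Set.univ.pi fun i => Set.Ioo (c i - h / 2) (c i + h / 2)) := by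
  ext x
  simp only [openCube, Set.mem_ofPred_eq, Set.mem_preimage, Set.mem_univ_pi, Set.mem_Ioo, abs_lt]
  exact forall_congr' fun i => ⟨fun ⟨h1, h2⟩ => ⟨by linarith, by linarith⟩,
    fun ⟨h1, h2⟩ => ⟨by linarith, by linarith⟩⟩

lemma isOpen_openCube {n : ℕ} (c : Euc n) (h : ℝ) : IsOpen (openCube c h) := by
  rw [openCube_eq_preimage]
  exact (isOpen_set_pi Set.finite_univ fun i _ => isOpen_Ioo).preimage
    (PiLp.continuous_ofLp 2 _)

lemma measurableSet_openCube {n : ℕ} (c : Euc n) (h : ℝ) : MeasurableSet (openCube c h) :=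
  (isOpen_openCube c h).measurableSet

lemma volume_openCube {n : ℕ} (c : Euc n) (h : ℝ) :
    volume (openCube c h) = ENNReal.ofReal h ^ n := by
  rw [openCube_eq_preimage, (PiLp.volume_preserving_ofLp (Fin n)).measure_preimage
    (MeasurableSet.univ_pi fun i => measurableSet_Ioo).nullMeasurableSet, Real.volume_pi_Ioo]
  simp only [add_sub_sub_cancel, add_halves, Finset.prod_const, Finset.card_univ, Fintype.card_fin]

lemma openCube_subset_closedCube {n : ℕ} (c : Euc n) (h : ℝ) : openCube c h ⊆ closedCube c h :=
  fun _ hx i => (hx i).le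

lemma center_mem_openCube {n : ℕ} (c : Euc n) {h : ℝ} (hh : 0 < h) : c ∈ openCube c h :=
  fun i => by simpa using hh

lemma dist_le_of_mem_closedCube {n : ℕ} {c : Euc n} {h : ℝ} (hh : 0 ≤ h) {x y : Euc n}
    (hx : x ∈ closedCube c h) (hy : y ∈ closedCube c h) : dist x y ≤ n * h := by
  rw [EuclideanSpace.dist_eq, Real.sqrt_le_left (by positivity)]
  have hi : ∀ i ∈ Finset.univ, dist (x i) (y i) ^ 2 ≤ h ^ 2 := fun i _ => by
    have h1 := abs_le.1 (hx i)
    have h2 := abs_le.1 (hy i)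
    refine pow_le_pow_left₀ dist_nonneg ?_ 2
    rw [Real.dist_eq, abs_le]
    constructor <;> linarith
  refine (Finset.sum_le_sum hi).trans ?_
  simp only [Finset.sum_const, Finset.card_univ, Fintype.card_fin, nsmul_eq_mul]
  rcases Nat.eq_zero_or_pos n with rfl | hn
  · simp
  have : (1 : ℝ) ≤ n := by exact_mod_cast hn
  nlinarith [mul_nonneg (sub_nonneg.2 this) (mul_nonneg (by linarith : (0 : ℝ) ≤ n) (sq_nonneg h))]

lemma isBounded_closedCube {n : ℕ} (c : Euc n) {h : ℝ} (hh : 0 ≤ h) :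
    Bornology.IsBounded (closedCube c h) :=
  Metric.isBounded_iff.2 ⟨n * h, fun _ hx _ hy => dist_le_of_mem_closedCube hh hx hy⟩

lemma diam_closedCube_le {n : ℕ} (c : Euc n) {h : ℝ} (hh : 0 ≤ h) :
    Metric.diam (closedCube c h) ≤ n * h :=
  Metric.diam_le_of_forall_dist_le (by positivity) fun _ hx _ hy =>
    dist_le_of_mem_closedCube hh hx hy

lemma le_diam_closedCube {n : ℕ} (hn : 0 < n) (c : Euc n) {h : ℝ} (hh : 0 ≤ h) :
    h ≤ Metric.diam (closedCube c h) := by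
  let e : Euc n := EuclideanSpace.single ⟨0, hn⟩ (h / 2)
  have he : ∀ i, |e i| ≤ h / 2 := fun i => by
    simp only [e, PiLp.single_apply]
    split_ifs
    · rw [abs_of_nonneg (by linarith)]
    · simp; linarith
  have h1 : c + e ∈ closedCube c h := fun i => by simpa using he i
  have h2 : c - e ∈ closedCube c h := fun i => by simpa using he i
  refine le_trans (le_of_eq ?_) (Metric.dist_le_diam_of_mem (isBounded_closedCube c hh) h1 h2)
  rw [dist_eq_norm, show c + e - (c - e) = (2 : ℝ) • e by rw [two_smul]; abel, norm_smul,
    PiLp.norm_single, Real.norm_of_nonneg (by norm_num),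
    Real.norm_of_nonneg (by linarith)]
  ring

lemma diam_closedCube_mul_le {n : ℕ} (c : Euc n) {K h : ℝ} (hK : 0 < K) (hh : 0 ≤ h) :
    Metric.diam (closedCube c (K * h)) ≤ K * Metric.diam (closedCube c h) := by
  have hmem : ∀ x ∈ closedCube c (K * h), c + K⁻¹ • (x - c) ∈ closedCube c h := fun x hx i => by
    have h1 := hx i
    simp only [PiLp.add_apply, PiLp.smul_apply, PiLp.sub_apply, smul_eq_mul, add_sub_cancel_left,
      abs_mul, abs_inv, abs_of_pos hK]
    rw [inv_mul_le_iff₀ hK]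
    linarith
  refine Metric.diam_le_of_forall_dist_le (mul_nonneg hK.le Metric.diam_nonneg)
    fun x hx y hy => ?_
  have h2 := Metric.dist_le_diam_of_mem (isBounded_closedCube c hh) (hmem x hx) (hmem y hy)
  rw [dist_add_left, dist_smul₀, dist_sub_right, Real.norm_of_nonneg (by positivity),
    inv_mul_le_iff₀ hK] at h2
  exact h2

lemma exists_mem_closedCube_dist_le {n : ℕ} {c : Euc n} {h : ℝ} (hh : 0 ≤ h) {x : Euc n}
    (hx : x ∈ openCube c (9 / 8 * h)) :
    ∃ z ∈ closedCube c h, dist x z ≤ Metric.diam (closedCube c h) / 8 := by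
  have hz : c + (8 / 9 : ℝ) • (x - c) ∈ closedCube c h := fun i => by
    have h1 := (hx i).le
    simp only [PiLp.add_apply, PiLp.smul_apply, PiLp.sub_apply, smul_eq_mul, add_sub_cancel_left,
      abs_mul]
    rw [abs_of_pos (by norm_num : (0 : ℝ) < 8 / 9)]
    linarith
  have hc : c ∈ closedCube c h := fun i => by simp; linarith
  refine ⟨_, hz, ?_⟩
  have h2 := Metric.dist_le_diam_of_mem (isBounded_closedCube c hh) hz hc
  rw [dist_eq_norm, add_sub_cancel_left, norm_smul, Real.norm_of_nonneg (by norm_num)] at h2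
  rw [dist_eq_norm, show x - (c + (8 / 9 : ℝ) • (x - c)) = (1 / 9 : ℝ) • (x - c) by
    module, norm_smul, Real.norm_of_nonneg (by norm_num)]
  linarith

namespace WhitneyDecomp

/-- The diameter of the Whitney cube `Q_t`. -/
def diamQ {n : ℕ} {Ω : Set (Euc n)} {Γ : Type} (wd : WhitneyDecomp n Ω Γ)
    (t : Γ) : ℝ := Metric.diam (closedCube (wd.c t) (wd.s t))

lemma s_le_diamQ {n : ℕ} {Ω : Set (Euc n)} {Γ : Type} (wd : WhitneyDecomp n Ω Γ)
    (hn : 0 < n) (t : Γ) : wd.s t ≤ wd.diamQ t :=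
  le_diam_closedCube hn _ (wd.s_pos t).le

lemma diamQ_pos {n : ℕ} {Ω : Set (Euc n)} {Γ : Type} (wd : WhitneyDecomp n Ω Γ)
    (hn : 0 < n) (t : Γ) : 0 < wd.diamQ t :=
  (wd.s_pos t).trans_le (wd.s_le_diamQ hn t)

lemma diamQ_le {n : ℕ} {Ω : Set (Euc n)} {Γ : Type} (wd : WhitneyDecomp n Ω Γ)
    (t : Γ) : wd.diamQ t ≤ n * wd.s t := diam_closedCube_le _ (wd.s_pos t).le

lemma le_distBd {n : ℕ} {Ω : Set (Euc n)} {Γ : Type} (wd : WhitneyDecomp n Ω Γ)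
    {t : Γ} {x : Euc n} (hx : x ∈ extCube wd t) :
    7 / 8 * wd.diamQ t ≤ distBd Ω x := by
  obtain ⟨z, hz, hd⟩ := exists_mem_closedCube_dist_le (wd.s_pos t).le hx
  have h1 := wd.diam_le_dist t z hz
  have h2 := Metric.infDist_le_infDist_add_dist (s := frontier Ω) (x := z) (y := x)
  rw [dist_comm] at h2
  unfold diamQ distBd
  linarith

lemma distBd_le {n : ℕ} {Ω : Set (Euc n)} {Γ : Type} (wd : WhitneyDecomp n Ω Γ)
    {t : Γ} {x : Euc n} (hx : x ∈ extCube wd t) : distBd Ω x ≤ 6 * wd.diamQ t := by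
  obtain ⟨z, hz, hd⟩ := exists_mem_closedCube_dist_le (wd.s_pos t).le hx
  obtain ⟨w, hw, hdw⟩ := wd.dist_le_diam t
  have h1 := Metric.dist_le_diam_of_mem (isBounded_closedCube _ (wd.s_pos t).le) hz hw
  have h2 := Metric.infDist_le_infDist_add_dist (s := frontier Ω) (x := x) (y := w)
  have h3 := dist_triangle x z w
  have h4 : 0 ≤ Metric.diam (closedCube (wd.c t) (wd.s t)) := Metric.diam_nonneg
  unfold diamQ distBd
  linarith

lemma distBd_pos {n : ℕ} {Ω : Set (Euc n)} {Γ : Type} (wd : WhitneyDecomp n Ω Γ)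
    (hn : 0 < n) {t : Γ} {x : Euc n} (hx : x ∈ extCube wd t) : 0 < distBd Ω x :=
  lt_of_lt_of_le (by have := wd.diamQ_pos hn t; positivity) (wd.le_distBd hx)

lemma extCube_subset {n : ℕ} {Ω : Set (Euc n)} {Γ : Type} (wd : WhitneyDecomp n Ω Γ)
    (hn : 0 < n) (hΩ : IsOpen Ω) (t : Γ) : extCube wd t ⊆ Ω := by
  intro x hx
  obtain ⟨z, hz, hd⟩ := exists_mem_closedCube_dist_le (wd.s_pos t).le hx
  have hδ := wd.diamQ_pos hn t
  have h1 := wd.diam_le_dist t z hz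
  unfold diamQ at hδ
  have hzΩ : z ∈ Ω := wd.cover ▸ Set.mem_iUnion.2 ⟨t, hz⟩
  have hxB : x ∈ Metric.ball z (Metric.infDist z (frontier Ω)) := by
    rw [Metric.mem_ball]; linarith
  have hzB : z ∈ Metric.ball z (Metric.infDist z (frontier Ω)) :=
    Metric.mem_ball_self (by linarith)
  refine (convex_ball z _).isPreconnected.subset_left_of_subset_union (v := (closure Ω)ᶜ) hΩ
    isClosed_closure.isOpen_compl ?_ ?_ ⟨z, hzB, hzΩ⟩ hxB
  · exact disjoint_compl_right.mono_left subset_closure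
  · intro y hy
    by_cases hyΩ : y ∈ Ω
    · exact Or.inl hyΩ
    · refine Or.inr fun hcl => Metric.ball_infDist_subset_compl hy ?_
      rw [hΩ.frontier_eq]
      exact ⟨hcl, hyΩ⟩

lemma pairwise_disjoint_openCube {n : ℕ} {Ω : Set (Euc n)} {Γ : Type} (wd : WhitneyDecomp n Ω Γ)
    :
    Pairwise (Function.onFun Disjoint fun t => openCube (wd.c t) (wd.s t)) := by
  intro t t' htt
  have hsub : ∀ t, openCube (wd.c t) (wd.s t) ⊆ interior (closedCube (wd.c t) (wd.s t)) :=
    fun t => interior_maximal (openCube_subset_closedCube _ _) (isOpen_openCube _ _)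
  exact (Set.disjoint_iff_inter_eq_empty.2 (wd.interior_disj htt)).mono (hsub t) (hsub t')

lemma countable {n : ℕ} {Ω : Set (Euc n)} {Γ : Type} (wd : WhitneyDecomp n Ω Γ)
    : Countable Γ :=
  wd.pairwise_disjoint_openCube.countable_of_isOpen_disjoint (fun _ => isOpen_openCube _ _)
    fun t => ⟨_, center_mem_openCube _ (wd.s_pos t)⟩

lemma openCube_subset_extCube {n : ℕ} {Ω : Set (Euc n)} {Γ : Type} (wd : WhitneyDecomp n Ω Γ)
    (t : Γ) : openCube (wd.c t) (wd.s t) ⊆ extCube wd t :=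
  fun _ hx i => (hx i).trans_le (by have := wd.s_pos t; linarith)

lemma measurableSet_extCube {n : ℕ} {Ω : Set (Euc n)} {Γ : Type} (wd : WhitneyDecomp n Ω Γ)
    (t : Γ) : MeasurableSet (extCube wd t) :=
  measurableSet_openCube _ _

lemma volume_extCube {n : ℕ} {Ω : Set (Euc n)} {Γ : Type} (wd : WhitneyDecomp n Ω Γ)
    (t : Γ) : volume (extCube wd t) =
    ENNReal.ofReal (9 / 8) ^ n * volume (openCube (wd.c t) (wd.s t)) := by
  rw [extCube, volume_openCube, volume_openCube, ENNReal.ofReal_mul (by norm_num), mul_pow]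

/-- Bounded overlap of the extended cubes, for finite families. -/
lemma card_le_of_mem_extCube {n : ℕ} {Ω : Set (Euc n)} {Γ : Type} (wd : WhitneyDecomp n Ω Γ)
    (hn : 0 < n) {x : Euc n} {F : Finset Γ}
    (hF : ∀ t ∈ F, x ∈ extCube wd t) : F.card ≤ (24 * n) ^ n := by
  rcases F.eq_empty_or_nonempty with rfl | ⟨t₀, ht₀⟩
  · simp
  have hρ := wd.distBd_pos hn (hF t₀ ht₀)
  set ρ := distBd Ω x
  have hn' : (0 : ℝ) < n := by exact_mod_cast hn
  have hsub : (⋃ t ∈ F, openCube (wd.c t) (wd.s t)) ⊆ openCube x (4 * ρ) := by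
    refine Set.iUnion₂_subset fun t ht y hy i => ?_
    have h1 := wd.le_distBd (hF t ht)
    have h2 := wd.s_le_diamQ hn t
    have h3 := abs_lt.1 (hy i)
    have h4 := abs_lt.1 (hF t ht i)
    have := wd.s_pos t
    rw [abs_lt]
    constructor <;> linarith
  have hvol := measure_mono (μ := volume) hsub
  rw [measure_biUnion_finset (fun t _ t' _ h => wd.pairwise_disjoint_openCube h)
    fun t _ => measurableSet_openCube _ _, volume_openCube] at hvol
  have hlow : ∀ t ∈ F, ENNReal.ofReal (ρ / (6 * n)) ^ n ≤
      volume (openCube (wd.c t) (wd.s t)) := fun t ht => by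
    rw [volume_openCube]
    gcongr
    have h1 := wd.distBd_le (hF t ht)
    have h2 := wd.diamQ_le t
    rw [div_le_iff₀ (by positivity)]
    linarith
  have hsum := (Finset.card_nsmul_le_sum F _ _ hlow).trans hvol
  rw [nsmul_eq_mul, ← ENNReal.ofReal_pow (by positivity), ← ENNReal.ofReal_pow (by positivity),
    ← ENNReal.ofReal_natCast, ← ENNReal.ofReal_mul (by positivity),
    ENNReal.ofReal_le_ofReal_iff (by positivity)] at hsum
  have h5 : (4 * ρ) ^ n = (24 * n) ^ n * (ρ / (6 * n)) ^ n := by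
    rw [← mul_pow]; congr 1; field_simp; norm_num
  rw [h5] at hsum
  have := le_of_mul_le_mul_right hsum (by positivity)
  exact_mod_cast this

lemma tsum_indicator_extCube_le {n : ℕ} {Ω : Set (Euc n)} {Γ : Type} (wd : WhitneyDecomp n Ω Γ)
    (hn : 0 < n) (x : Euc n) :
    ∑' t, (extCube wd t).indicator (fun _ => (1 : ℝ≥0∞)) x ≤ ((24 * n) ^ n : ℕ) := by
  classical
  rw [ENNReal.tsum_eq_iSup_sum]
  refine iSup_le fun S => ?_
  simp only [Set.indicator_apply]
  rw [Finset.sum_boole]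
  exact_mod_cast wd.card_le_of_mem_extCube hn fun t ht => (Finset.mem_filter.1 ht).2

lemma tsum_setLIntegral_extCube_le {n : ℕ} {Ω : Set (Euc n)} {Γ : Type} (wd : WhitneyDecomp n Ω Γ)
    (hn : 0 < n) (hΩ : IsOpen Ω) {f : Euc n → ℝ≥0∞}
    (hf : AEMeasurable f (volume.restrict Ω)) :
    ∑' t, ∫⁻ x in extCube wd t, f x ≤ ((24 * n) ^ n : ℕ) * ∫⁻ x in Ω, f x := by
  have := wd.countable
  have h1 : ∀ t, ∫⁻ x in extCube wd t, f x =
      ∫⁻ x in Ω, (extCube wd t).indicator (fun _ => (1 : ℝ≥0∞)) x * f x := fun t => by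
    rw [← Measure.restrict_restrict_of_subset (wd.extCube_subset hn hΩ t),
      ← lintegral_indicator (wd.measurableSet_extCube t)]
    refine lintegral_congr fun x => ?_
    by_cases hx : x ∈ extCube wd t <;> simp [hx]
  simp_rw [h1]
  have h2 : ∀ t, AEMeasurable
      (fun x => (extCube wd t).indicator (fun _ => (1 : ℝ≥0∞)) x * f x) (volume.restrict Ω) :=
    fun t => ((measurable_const.indicator (wd.measurableSet_extCube t)).aemeasurable).mul hf
  rw [← lintegral_tsum h2, ← lintegral_const_mul' _ _ (ENNReal.natCast_ne_top _)]
  refine lintegral_mono fun x => ?_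
  rw [ENNReal.tsum_mul_right]
  gcongr
  exact wd.tsum_indicator_extCube_le hn x

end WhitneyDecomp

lemma lintegral_rpow_le_mul_lintegral_rpow {α : Type*} [MeasurableSpace α] (μ : Measure α) {q : ℝ}
    (hq : 1 < q) {f : α → ℝ≥0∞} (hf : AEMeasurable f μ) :
    (∫⁻ x, f x ∂μ) ^ q ≤ μ Set.univ ^ (q - 1) * ∫⁻ x, f x ^ q ∂μ := by
  have hq0 : 0 < q := by linarith
  have h := ENNReal.lintegral_mul_le_Lp_mul_Lq μ (Real.HolderConjugate.conjExponent hq) hf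
    (aemeasurable_const (b := (1 : ℝ≥0∞)))
  simp only [Pi.mul_apply, mul_one, ENNReal.one_rpow, lintegral_one] at h
  refine (ENNReal.rpow_le_rpow h hq0.le).trans (le_of_eq ?_)
  have h1 : 1 / q * q = 1 := by field_simp
  have h2 : 1 / q.conjExponent * q = q - 1 := by
    have : q - 1 ≠ 0 := by linarith
    simp only [Real.conjExponent]; field_simp
  rw [ENNReal.mul_rpow_of_nonneg _ _ hq0.le, ← ENNReal.rpow_mul, ← ENNReal.rpow_mul, h1, h2,
    ENNReal.rpow_one, mul_comm]

namespace TreeStruct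

/-- Number of steps from `t` to the root. -/
def depth {n : ℕ} {Ω : Set (Euc n)} {Γ : Type} {wd : WhitneyDecomp n Ω Γ} (T : TreeStruct wd)
    (t : Γ) : ℕ :=
  sInf {k | T.parent^[k] t = T.root}

lemma isDepth {n : ℕ} {Ω : Set (Euc n)} {Γ : Type} {wd : WhitneyDecomp n Ω Γ}
    (T : TreeStruct wd) : IsDepth T.parent T.depth where
  step t ht := by
    have hmem : ∀ s, T.parent^[T.depth s] s = T.root := fun s => Nat.sInf_mem (T.reaches_root s)
    apply le_antisymm
    · refine Nat.sInf_le ?_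
      rw [Set.mem_ofPred_eq, Function.iterate_succ_apply]
      exact hmem (T.parent t)
    · obtain ⟨k, hk⟩ := Nat.exists_eq_succ_of_ne_zero ht
      have h := hmem t
      rw [hk, Function.iterate_succ_apply] at h
      rw [hk]
      exact Nat.succ_le_succ (Nat.sInf_le h)
  root t ht := by
    have h : T.parent^[T.depth t] t = T.root := Nat.sInf_mem (T.reaches_root t)
    rw [ht, Function.iterate_zero_apply] at h
    rw [h, T.parent_root]

lemma setLIntegral_shadow_le {n : ℕ} {Ω : Set (Euc n)} {Γ : Type} {wd : WhitneyDecomp n Ω Γ}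
    (T : TreeStruct wd) (f : Euc n → ℝ≥0∞) (t : Γ) :
    ∫⁻ x in shadow T t, f x ≤ descSum T.parent (fun s => ∫⁻ x in extCube wd s, f x) t := by
  have := wd.countable
  refine (lintegral_iUnion_le _ _).trans (ENNReal.tsum_le_tsum fun s => ?_)
  by_cases hs : ∃ k : ℕ, T.parent^[k] s = t
  · have hs' : treeLE T t s := hs
    simp only [hs', Set.iUnion_true, if_pos hs, le_refl]
  · have hs' : ¬ treeLE T t s := hs
    simp [hs']

lemma descSum_volume_le {n : ℕ} {Ω : Set (Euc n)} {Γ : Type} {wd : WhitneyDecomp n Ω Γ}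
    (T : TreeStruct wd) (t : Γ) :
    descSum T.parent (fun s => volume (openCube (wd.c s) (wd.s s))) t ≤
      volume (shadow T t) := by
  have := wd.countable
  have hsub : (⋃ (s : Γ) (_ : treeLE T t s), openCube (wd.c s) (wd.s s)) ⊆ shadow T t :=
    Set.iUnion₂_mono fun s _ => wd.openCube_subset_extCube s
  refine le_trans (le_of_eq ?_) (measure_mono hsub)
  rw [measure_iUnion]
  · refine tsum_congr fun s => ?_
    by_cases hs : ∃ k : ℕ, T.parent^[k] s = t
    · have hs' : treeLE T t s := hs
      simp only [hs', Set.iUnion_true, if_pos hs]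
    · have hs' : ¬ treeLE T t s := hs
      simp [hs', hs]
  · intro s s' hss
    exact (wd.pairwise_disjoint_openCube hss).mono (Set.iUnion_subset fun _ => le_rfl)
      (Set.iUnion_subset fun _ => le_rfl)
  · exact fun s => MeasurableSet.iUnion fun _ => measurableSet_openCube _ _

lemma shadow_subset {n : ℕ} {Ω : Set (Euc n)} {Γ : Type} {wd : WhitneyDecomp n Ω Γ}
    (T : TreeStruct wd) (hn : 0 < n) (hΩ : IsOpen Ω) (t : Γ) : shadow T t ⊆ Ω :=
  Set.iUnion₂_subset fun s _ => wd.extCube_subset hn hΩ s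

end TreeStruct

/-- The average of `|u|` over the shadow of `t`, as in the definition of `hardyT`. -/
def shadowAverage {n : ℕ} {Ω : Set (Euc n)} {Γ : Type} {wd : WhitneyDecomp n Ω Γ}
    (T : TreeStruct wd) (u : Euc n → ℝ) (t : Γ) : ℝ :=
  (∫ y in shadow T t, |u y|) / (volume (shadow T t)).toReal

lemma shadowAverage_nonneg {n : ℕ} {Ω : Set (Euc n)} {Γ : Type} {wd : WhitneyDecomp n Ω Γ}
    (T : TreeStruct wd) (u : Euc n → ℝ) (t : Γ) : 0 ≤ shadowAverage T u t :=
  div_nonneg (integral_nonneg fun _ => abs_nonneg _) ENNReal.toReal_nonneg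

/-- The modulus of `u` multiplied by the weight `ρ^{-β}`. -/
def weighted {n : ℕ} (Ω : Set (Euc n)) (β : ℝ) (u : Euc n → ℝ) (x : Euc n) : ℝ≥0∞ :=
  ENNReal.ofReal (|u x| * distBd Ω x ^ (-β))

lemma aemeasurable_weighted {n : ℕ} {Ω : Set (Euc n)} (β : ℝ) {u : Euc n → ℝ}
    (hu : AEStronglyMeasurable u (volume.restrict Ω)) :
    AEMeasurable (weighted Ω β u) (volume.restrict Ω) := by
  refine (hu.norm.aemeasurable.mul ?_).ennreal_ofReal
  exact (((Metric.continuous_infDist_pt (frontier Ω)).measurable).pow_const (-β)).aemeasurable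

lemma lintegral_weighted_rpow {n : ℕ} {Ω : Set (Euc n)} {q β : ℝ} (hq : 0 ≤ q)
    {u : Euc n → ℝ}
    (hu : IntegrableOn (fun x => |u x| ^ q * distBd Ω x ^ (-(q * β))) Ω) :
    ∫⁻ x in Ω, weighted Ω β u x ^ q =
      ENNReal.ofReal (∫ x in Ω, |u x| ^ q * distBd Ω x ^ (-(q * β))) := by
  have hd : ∀ x, 0 ≤ distBd Ω x := fun x => Metric.infDist_nonneg
  rw [ofReal_integral_eq_lintegral_ofReal hu (Filter.Eventually.of_forall fun x =>
    mul_nonneg (Real.rpow_nonneg (abs_nonneg _) _) (Real.rpow_nonneg (hd x) _))]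
  refine lintegral_congr fun x => ?_
  rw [weighted, ENNReal.ofReal_rpow_of_nonneg
    (mul_nonneg (abs_nonneg _) (Real.rpow_nonneg (hd x) _)) hq,
    Real.mul_rpow (abs_nonneg _) (Real.rpow_nonneg (hd x) _), ← Real.rpow_mul (hd x)]
  congr 3
  ring

lemma WhitneyDecomp.rpow_diamQ_le {n : ℕ} {Ω : Set (Euc n)} {Γ : Type}
    (wd : WhitneyDecomp n Ω Γ) (hn : 0 < n) {β K : ℝ} (hβ : 0 ≤ β) (hK : 0 < K) {s t : Γ}
    (hst : closedCube (wd.c s) (wd.s s) ⊆ closedCube (wd.c t) (K * wd.s t))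
    {x : Euc n} (hx : x ∈ extCube wd s) :
    (7 / 8 * wd.diamQ t) ^ (-β) ≤ (7 * K) ^ β * distBd Ω x ^ (-β) := by
  have hδ := wd.diamQ_pos hn t
  have hρ := wd.distBd_pos hn hx
  have h1 : wd.diamQ s ≤ K * wd.diamQ t :=
    (Metric.diam_mono hst (isBounded_closedCube _ (mul_pos hK (wd.s_pos t)).le)).trans
      (diam_closedCube_mul_le _ hK (wd.s_pos t).le)
  have h2 := wd.distBd_le hx
  have h3 : (7 * K)⁻¹ * distBd Ω x ≤ 7 / 8 * wd.diamQ t := by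
    rw [inv_mul_le_iff₀ (by positivity)]
    nlinarith [mul_pos hK hδ]
  refine (Real.rpow_le_rpow_of_nonpos (by positivity) h3 (by linarith)).trans (le_of_eq ?_)
  rw [Real.mul_rpow (by positivity) hρ.le, Real.inv_rpow (by positivity),
    Real.rpow_neg (by positivity), inv_inv]

lemma ofReal_shadowAverage_le {n : ℕ} {Ω : Set (Euc n)} {Γ : Type} {wd : WhitneyDecomp n Ω Γ}
    (T : TreeStruct wd) (hn : 0 < n) (hΩ : IsOpen Ω) (hΩ' : volume Ω ≠ ⊤) {β K : ℝ}
    (hβ : 0 ≤ β) (hK : 0 < K)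
    (hTK : ∀ s t : Γ, treeLE T t s →
      closedCube (wd.c s) (wd.s s) ⊆ closedCube (wd.c t) (K * wd.s t))
    (u : Euc n → ℝ) (t : Γ) :
    ENNReal.ofReal ((7 / 8 * wd.diamQ t) ^ (-β)) * ENNReal.ofReal (shadowAverage T u t) ≤
      ENNReal.ofReal ((7 * K) ^ β) *
        (descSum T.parent (fun s => ∫⁻ x in extCube wd s, weighted Ω β u x) t /
          descSum T.parent (fun s => volume (openCube (wd.c s) (wd.s s))) t) := by
  have hW := T.descSum_volume_le t
  have hm0 : 0 < volume (openCube (wd.c t) (wd.s t)) := by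
    rw [volume_openCube]
    exact ENNReal.pow_pos (ENNReal.ofReal_pos.2 (wd.s_pos t)) n
  have hW0 : 0 < volume (shadow T t) :=
    hm0.trans_le ((le_descSum T.parent (fun s => volume (openCube (wd.c s) (wd.s s))) t).trans hW)
  have hWtop : volume (shadow T t) ≠ ⊤ :=
    ne_top_of_le_ne_top hΩ' (measure_mono (T.shadow_subset hn hΩ t))
  have hint : ENNReal.ofReal (∫ y in shadow T t, |u y|) ≤
      ∫⁻ y in shadow T t, ENNReal.ofReal |u y| := by
    have h1 := norm_integral_le_lintegral_norm (μ := volume.restrict (shadow T t))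
      fun y => |u y|
    simp only [norm_abs_eq_norm, Real.norm_eq_abs] at h1
    exact (ENNReal.ofReal_le_ofReal ((le_abs_self _).trans h1)).trans ENNReal.ofReal_toReal_le
  have hsum : ENNReal.ofReal ((7 / 8 * wd.diamQ t) ^ (-β)) *
      descSum T.parent (fun s => ∫⁻ x in extCube wd s, ENNReal.ofReal |u x|) t ≤
      ENNReal.ofReal ((7 * K) ^ β) *
        descSum T.parent (fun s => ∫⁻ x in extCube wd s, weighted Ω β u x) t := by
    rw [descSum, descSum, ← ENNReal.tsum_mul_left, ← ENNReal.tsum_mul_left]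
    refine ENNReal.tsum_le_tsum fun s => ?_
    split_ifs with hs
    · rw [← lintegral_const_mul' _ _ ENNReal.ofReal_ne_top,
        ← lintegral_const_mul' _ _ ENNReal.ofReal_ne_top]
      refine setLIntegral_mono' (measurableSet_openCube _ _) fun x hx => ?_
      have hδ := wd.diamQ_pos hn t
      rw [weighted, ← ENNReal.ofReal_mul (by positivity), ← ENNReal.ofReal_mul (by positivity)]
      refine ENNReal.ofReal_le_ofReal ?_
      calc _ ≤ (7 * K) ^ β * distBd Ω x ^ (-β) * |u x| := by
            gcongr
            exact wd.rpow_diamQ_le hn hβ hK (hTK s t hs) hx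
        _ = _ := by ring
    · simp
  rw [shadowAverage, ENNReal.ofReal_div_of_pos (ENNReal.toReal_pos hW0.ne' hWtop),
    ENNReal.ofReal_toReal hWtop, ← mul_div_assoc, ← mul_div_assoc]
  refine ENNReal.div_le_div (le_trans ?_ hsum) hW
  gcongr
  exact hint.trans (T.setLIntegral_shadow_le _ t)

lemma ofReal_hardyT_le {n : ℕ} {Ω : Set (Euc n)} {Γ : Type} {wd : WhitneyDecomp n Ω Γ}
    (T : TreeStruct wd) (hn : 0 < n) {q β : ℝ} (hq : 0 < q) (hβ : 0 ≤ β)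
    {Bc : Γ → Euc n} {Bh : Γ → ℝ}
    (hB : ∀ t, t ≠ T.root → openCube (Bc t) (Bh t) ⊆ extCube wd t)
    (hdisj : ∀ t t', t ≠ t' → t ≠ T.root → t' ≠ T.root →
      openCube (Bc t) (Bh t) ∩ openCube (Bc t') (Bh t') = ∅)
    (u : Euc n → ℝ) (x : Euc n) :
    ENNReal.ofReal ‖hardyT T Bc Bh u x ^ q * distBd Ω x ^ (-(q * β))‖ ≤
      ∑' t, (extCube wd t).indicator (fun _ =>
        (ENNReal.ofReal ((7 / 8 * wd.diamQ t) ^ (-β)) *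
          ENNReal.ofReal (shadowAverage T u t)) ^ q) x := by
  classical
  by_cases hx : ∃ t, t ≠ T.root ∧ x ∈ openCube (Bc t) (Bh t)
  · obtain ⟨t, ht, hxt⟩ := hx
    have hT : hardyT T Bc Bh u x = shadowAverage T u t := by
      rw [hardyT, finsum_eq_single _ t, if_neg ht, Set.indicator_of_mem hxt, shadowAverage]
      intro t' ht'
      split_ifs with h0
      · rfl
      · refine Set.indicator_of_notMem (fun hx' => ?_) _
        have : x ∈ openCube (Bc t') (Bh t') ∩ openCube (Bc t) (Bh t) := ⟨hx', hxt⟩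
        rw [hdisj t' t ht' h0 ht] at this
        exact this
    have hxe := hB t ht hxt
    refine le_trans ?_ (ENNReal.le_tsum t)
    have ha := shadowAverage_nonneg T u t
    have hδ := wd.diamQ_pos hn t
    have hρ := wd.distBd_pos hn hxe
    rw [Set.indicator_of_mem hxe, hT, Real.norm_of_nonneg (by positivity),
      ← ENNReal.ofReal_mul (by positivity), ENNReal.ofReal_rpow_of_nonneg (by positivity) hq.le]
    refine ENNReal.ofReal_le_ofReal ?_
    rw [Real.mul_rpow (by positivity) ha, ← Real.rpow_mul (by positivity), mul_comm,
      show -(q * β) = -β * q by ring]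
    gcongr ?_ * _
    exact Real.rpow_le_rpow_of_nonpos (by positivity) (wd.le_distBd hxe) (by nlinarith)
  · have hT : hardyT T Bc Bh u x = 0 := by
      rw [hardyT]
      refine finsum_eq_zero_of_forall_eq_zero fun t => ?_
      split_ifs with h0
      · rfl
      · exact Set.indicator_of_notMem (fun h => hx ⟨t, h0, h⟩) _
    rw [hT, Real.zero_rpow hq.ne']
    simp

lemma tsum_volume_mul_rpow_le {n : ℕ} {Ω : Set (Euc n)} {Γ : Type} (wd : WhitneyDecomp n Ω Γ)
    (hn : 0 < n) (hΩ : IsOpen Ω) {q : ℝ} (hq : 1 < q) {f : Euc n → ℝ≥0∞}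
    (hf : AEMeasurable f (volume.restrict Ω)) :
    ∑' s, volume (openCube (wd.c s) (wd.s s)) *
        ((∫⁻ x in extCube wd s, f x) / volume (openCube (wd.c s) (wd.s s))) ^ q ≤
      (ENNReal.ofReal (9 / 8) ^ n) ^ (q - 1) * (((24 * n) ^ n : ℕ) * ∫⁻ x in Ω, f x ^ q) := by
  have hq0 : 0 < q := by linarith
  refine le_trans (ENNReal.tsum_le_tsum fun s => ?_) (le_trans (le_of_eq ENNReal.tsum_mul_left)
    (mul_le_mul_right (wd.tsum_setLIntegral_extCube_le hn hΩ (hf.pow_const q)) _))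
  set m := volume (openCube (wd.c s) (wd.s s)) with hm
  have hm' : m = ENNReal.ofReal (wd.s s) ^ n := volume_openCube _ _
  have hm0 : m ≠ 0 := by
    rw [hm']; exact (ENNReal.pow_pos (ENNReal.ofReal_pos.2 (wd.s_pos s)) n).ne'
  have hmtop : m ≠ ⊤ := by rw [hm']; finiteness
  have hJ := lintegral_rpow_le_mul_lintegral_rpow (volume.restrict (extCube wd s)) hq
    (hf.mono_measure (Measure.restrict_mono (wd.extCube_subset hn hΩ s) le_rfl))
  rw [Measure.restrict_apply_univ, wd.volume_extCube, ← hm,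
    ENNReal.mul_rpow_of_nonneg _ _ (by linarith : 0 ≤ q - 1)] at hJ
  set c := (ENNReal.ofReal (9 / 8) ^ n) ^ (q - 1)
  set J := ∫⁻ x in extCube wd s, f x ^ q
  have hmq0 : m ^ q ≠ 0 := by simp [hm0, hmtop]
  have hmqtop : m ^ q ≠ ⊤ := ENNReal.rpow_ne_top_of_nonneg hq0.le hmtop
  rw [ENNReal.div_rpow_of_nonneg _ _ hq0.le, ← mul_div_assoc,
    ENNReal.div_le_iff hmq0 hmqtop, ENNReal.rpow_eq_rpow_sub_one_mul hq m]
  calc m * (∫⁻ x in extCube wd s, f x) ^ q ≤ m * (c * m ^ (q - 1) * J) := by gcongr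
    _ = _ := by ring

/-- The weighted bound in terms of `ℝ≥0∞`-valued integrals. -/
lemma lintegral_hardyT_le {n : ℕ} {Ω : Set (Euc n)} {Γ : Type} {wd : WhitneyDecomp n Ω Γ}
    (T : TreeStruct wd) (hn : 0 < n) (hΩ : IsOpen Ω) (hΩ' : volume Ω ≠ ⊤) {q β K : ℝ}
    (hq : 1 < q) (hβ : 0 ≤ β) (hK : 0 < K)
    (hTK : ∀ s t : Γ, treeLE T t s →
      closedCube (wd.c s) (wd.s s) ⊆ closedCube (wd.c t) (K * wd.s t))
    {Bc : Γ → Euc n} {Bh : Γ → ℝ}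
    (hB : ∀ t, t ≠ T.root → openCube (Bc t) (Bh t) ⊆ extCube wd t)
    (hdisj : ∀ t t', t ≠ t' → t ≠ T.root → t' ≠ T.root →
      openCube (Bc t) (Bh t) ∩ openCube (Bc t') (Bh t') = ∅)
    {u : Euc n → ℝ} (hu : AEStronglyMeasurable u (volume.restrict Ω))
    (hfin : ∫⁻ x in Ω, weighted Ω β u x ^ q ≠ ⊤) :
    ENNReal.ofReal ((q - 1) / 2) * ∫⁻ x in Ω,
        ENNReal.ofReal ‖hardyT T Bc Bh u x ^ q * distBd Ω x ^ (-(q * β))‖ ≤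
      ENNReal.ofReal (9 / 8) ^ n * ENNReal.ofReal ((7 * K) ^ β) ^ q *
        ((ENNReal.ofReal (q * (q / ((q - 1) / 2)) ^ (q - 1)) + 1) *
          ((ENNReal.ofReal (9 / 8) ^ n) ^ (q - 1) *
            (((24 * n) ^ n : ℕ) * ∫⁻ x in Ω, weighted Ω β u x ^ q))) := by
  have hq0 : 0 < q := by linarith
  have := wd.countable
  have hf := aemeasurable_weighted β hu
  set f := weighted Ω β u with hfdef
  set m : Γ → ℝ≥0∞ := fun s => volume (openCube (wd.c s) (wd.s s)) with hmdef
  set I : Γ → ℝ≥0∞ := fun s => ∫⁻ x in extCube wd s, f x with hI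
  have hm0 : ∀ s, m s ≠ 0 := fun s => by
    simp only [hmdef, volume_openCube]
    exact (ENNReal.pow_pos (ENNReal.ofReal_pos.2 (wd.s_pos s)) n).ne'
  have hmtop : ∀ s, m s ≠ ⊤ := fun s => by
    simp only [hmdef, volume_openCube]; finiteness
  have hmI : ∀ s, m s * (I s / m s) = I s := fun s => ENNReal.mul_div_cancel (hm0 s) (hmtop s)
  have hmsum : ∑' s, m s ≠ ⊤ := by
    have h1 := wd.tsum_setLIntegral_extCube_le hn hΩ (aemeasurable_const (b := (1 : ℝ≥0∞)))
    simp only [setLIntegral_one] at h1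
    refine ne_top_of_le_ne_top (ENNReal.mul_ne_top (ENNReal.natCast_ne_top _) hΩ')
      (le_trans (ENNReal.tsum_le_tsum fun s => ?_) h1)
    exact measure_mono (wd.openCube_subset_extCube s)
  have hIsum : ∑' s, I s ≠ ⊤ := by
    refine ne_top_of_le_ne_top (ENNReal.mul_ne_top (ENNReal.natCast_ne_top _) ?_)
      (wd.tsum_setLIntegral_extCube_le hn hΩ hf)
    have h1 : ∫⁻ x in Ω, f x ≤ ∫⁻ x in Ω, (1 + f x ^ q) := by
      refine lintegral_mono fun x => ?_
      rcases le_total (f x) 1 with h | h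
      · exact h.trans le_self_add
      · refine le_trans ?_ le_add_self
        simpa using ENNReal.rpow_le_rpow_of_exponent_le h hq.le
    rw [lintegral_add_left measurable_const, setLIntegral_one] at h1
    exact ne_top_of_le_ne_top (ENNReal.add_ne_top.2 ⟨hΩ', hfin⟩) h1
  have htree := tsum_mul_descAverage_rpow_le hq T.isDepth m (fun s => I s / m s) hm0 hmsum
    (by simp_rw [hmI]; exact hIsum)
  simp_rw [hmI] at htree
  have hpt : ∫⁻ x in Ω, ENNReal.ofReal ‖hardyT T Bc Bh u x ^ q * distBd Ω x ^ (-(q * β))‖ ≤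
      ENNReal.ofReal (9 / 8) ^ n * ENNReal.ofReal ((7 * K) ^ β) ^ q *
        ∑' t, m t * (descSum T.parent I t / descSum T.parent m t) ^ q := by
    refine (lintegral_mono fun x => ofReal_hardyT_le T hn hq0 hβ hB hdisj u x).trans ?_
    rw [lintegral_tsum fun t =>
      (measurable_const.indicator (wd.measurableSet_extCube t)).aemeasurable,
      ← ENNReal.tsum_mul_left]
    refine ENNReal.tsum_le_tsum fun t => ?_
    rw [lintegral_indicator_const (wd.measurableSet_extCube t)]
    calc _ ≤ (ENNReal.ofReal ((7 * K) ^ β) *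
          (descSum T.parent I t / descSum T.parent m t)) ^ q * volume (extCube wd t) :=
          mul_le_mul' (ENNReal.rpow_le_rpow
            (ofReal_shadowAverage_le T hn hΩ hΩ' hβ hK hTK u t) hq0.le)
            (Measure.restrict_apply_le _ _)
      _ = _ := by
          rw [wd.volume_extCube, ENNReal.mul_rpow_of_nonneg _ _ hq0.le]
          ring
  have hlast := tsum_volume_mul_rpow_le wd hn hΩ hq hf
  calc _ ≤ ENNReal.ofReal ((q - 1) / 2) * (ENNReal.ofReal (9 / 8) ^ n *
        ENNReal.ofReal ((7 * K) ^ β) ^ q *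
        ∑' t, m t * (descSum T.parent I t / descSum T.parent m t) ^ q) := by gcongr
    _ = ENNReal.ofReal (9 / 8) ^ n * ENNReal.ofReal ((7 * K) ^ β) ^ q *
        (ENNReal.ofReal ((q - 1) / 2) *
        ∑' t, m t * (descSum T.parent I t / descSum T.parent m t) ^ q) := by ring
    _ ≤ _ := mul_le_mul' le_rfl (htree.trans (mul_le_mul' le_rfl hlast))

/-- The constant of the weighted bound, raised to the power `q`. -/
def hardyConst (n : ℕ) (q β : ℝ) : ℝ :=
  ((q - 1) / 2)⁻¹ * ((9 / 8) ^ n * ((7 : ℝ) ^ β) ^ q *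
    ((q * (q / ((q - 1) / 2)) ^ (q - 1) + 1) *
      (((9 / 8 : ℝ) ^ n) ^ (q - 1) * ((24 * n) ^ n : ℕ))))

lemma hardyConst_pos (n : ℕ) {q : ℝ} (hq : 1 < q) (β : ℝ) : 0 < hardyConst n q β := by
  have : 0 < q - 1 := by linarith
  have hN : (0 : ℝ) < ((24 * n) ^ n : ℕ) := by
    rcases Nat.eq_zero_or_pos n with rfl | hn
    · simp
    · positivity
  unfold hardyConst
  positivity

lemma hardyT_eq_zero {Ω : Set (Euc 0)} {Γ : Type} {wd : WhitneyDecomp 0 Ω Γ}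
    (T : TreeStruct wd) (Bc : Γ → Euc 0) (Bh : Γ → ℝ) (u : Euc 0 → ℝ) (x : Euc 0) :
    hardyT T Bc Bh u x = 0 := by
  rw [hardyT]
  refine finsum_eq_zero_of_forall_eq_zero fun t => if_pos ?_
  by_contra ht
  have hx : ∀ s, x ∈ openCube (wd.c s) (wd.s s) := fun s i => i.elim0
  exact Set.disjoint_left.1 (wd.pairwise_disjoint_openCube ht) (hx _) (hx _)

/-- the Hardy-type operator `T` is bounded on `L^q(Ω, ρ^{−β})` with operator
norm at most `C K^β`, where `C` is independent of `Ω` (it may depend on `n`, `q`, `β` and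
the dimensional constant `CB` of the family `{B_t}`), and `K` is the geometric constant of
the tree structure. -/
theorem hardy_type_operator_weighted_bound
    (n : ℕ) (q β CB : ℝ) (hq1 : 1 < q) (hβ : 0 ≤ β) (hCB : 0 < CB) :
    ∃ C : ℝ, 0 < C ∧
      ∀ (Ω : Set (Euc n)), IsOpen Ω → IsConnected Ω → Bornology.IsBounded Ω →
        IsJohnDomain Ω →
      ∀ (Γ : Type) (wd : WhitneyDecomp n Ω Γ) (T : TreeStruct wd) (K : ℝ), 1 < K →
        (∀ s t : Γ, treeLE T t s →
          closedCube (wd.c s) (wd.s s) ⊆ closedCube (wd.c t) (K * wd.s t)) →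
      ∀ (Bc : Γ → Euc n) (Bh : Γ → ℝ),
        (∀ t, t ≠ T.root → 0 < Bh t ∧
          openCube (Bc t) (Bh t) ⊆ extCube wd t ∩ extCube wd (T.parent t)) →
        (∀ t t', t ≠ t' → t ≠ T.root → t' ≠ T.root →
          openCube (Bc t) (Bh t) ∩ openCube (Bc t') (Bh t') = ∅) →
        (∀ t, t ≠ T.root →
          volume (extCube wd t) ≤ ENNReal.ofReal CB * volume (openCube (Bc t) (Bh t))) →
      ∀ u : Euc n → ℝ, AEStronglyMeasurable u (volume.restrict Ω) → IntegrableOn u Ω →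
        IntegrableOn (fun x => |u x| ^ q * distBd Ω x ^ (-(q * β))) Ω →
        (∫ x in Ω, hardyT T Bc Bh u x ^ q * distBd Ω x ^ (-(q * β))) ^ (1 / q)
          ≤ C * K ^ β * (∫ x in Ω, |u x| ^ q * distBd Ω x ^ (-(q * β))) ^ (1 / q) := by
  have hq0 : 0 < q := by linarith
  have hC0 := hardyConst_pos n hq1 β
  refine ⟨hardyConst n q β ^ (1 / q), Real.rpow_pos_of_pos hC0 _, ?_⟩
  intro Ω hΩ _ hbdd _ Γ wd T K hK hTK Bc Bh hB hdisj _ u hu _ huq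
  have hd : ∀ x, 0 ≤ distBd Ω x := fun x => Metric.infDist_nonneg
  have hY : 0 ≤ ∫ x in Ω, |u x| ^ q * distBd Ω x ^ (-(q * β)) :=
    integral_nonneg fun x =>
      mul_nonneg (Real.rpow_nonneg (abs_nonneg _) _) (Real.rpow_nonneg (hd x) _)
  set Y := ∫ x in Ω, |u x| ^ q * distBd Ω x ^ (-(q * β)) with hYdef
  have hK0 : 0 < K := by linarith
  rcases Nat.eq_zero_or_pos n with rfl | hn
  · simp only [hardyT_eq_zero, Real.zero_rpow hq0.ne', zero_mul, integral_zero]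
    rw [Real.zero_rpow (by positivity)]
    positivity
  have hYeq := lintegral_weighted_rpow hq0.le huq
  have hmain := lintegral_hardyT_le T hn hΩ hbdd.measure_lt_top.ne hq1 hβ hK0 hTK
    (fun t ht => (hB t ht).2.trans Set.inter_subset_left) hdisj hu
    (by rw [hYeq]; exact ENNReal.ofReal_ne_top)
  rw [hYeq, ← hYdef] at hmain
  have hq1' : 0 < q - 1 := by linarith
  have hA : 0 ≤ q * (q / ((q - 1) / 2)) ^ (q - 1) := by positivity
  have hX : ∫⁻ x in Ω, ENNReal.ofReal
      ‖hardyT T Bc Bh u x ^ q * distBd Ω x ^ (-(q * β))‖ ≤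
      ENNReal.ofReal (hardyConst n q β * (K ^ β) ^ q * Y) := by
    have hκ0 : ENNReal.ofReal ((q - 1) / 2) ≠ 0 := (ENNReal.ofReal_pos.2 (by linarith)).ne'
    refine (ENNReal.mul_le_mul_iff_right hκ0 ENNReal.ofReal_ne_top).1 (hmain.trans (le_of_eq ?_))
    rw [← ENNReal.ofReal_pow (by positivity),
      ENNReal.ofReal_rpow_of_nonneg (by positivity) hq0.le,
      ENNReal.ofReal_rpow_of_nonneg (by positivity) hq1'.le, ← ENNReal.ofReal_one,
      ← ENNReal.ofReal_add hA zero_le_one, ← ENNReal.ofReal_natCast,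
      ← ENNReal.ofReal_mul (by positivity), ← ENNReal.ofReal_mul (by positivity),
      ← ENNReal.ofReal_mul (by positivity), ← ENNReal.ofReal_mul (by positivity),
      ← ENNReal.ofReal_mul (by positivity), ← ENNReal.ofReal_mul (by positivity)]
    congr 1
    rw [hardyConst, Real.mul_rpow (by norm_num) hK0.le,
      Real.mul_rpow (by positivity) (by positivity)]
    field_simp
  have hXr : (∫ x in Ω, hardyT T Bc Bh u x ^ q * distBd Ω x ^ (-(q * β))) ≤
      hardyConst n q β * (K ^ β) ^ q * Y :=
    (le_abs_self _).trans ((norm_integral_le_lintegral_norm _).trans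
      (ENNReal.toReal_le_of_le_ofReal (by positivity) hX))
  have hX0 : 0 ≤ ∫ x in Ω, hardyT T Bc Bh u x ^ q * distBd Ω x ^ (-(q * β)) := by
    refine integral_nonneg fun x =>
      mul_nonneg (Real.rpow_nonneg (finsum_nonneg fun t => ?_) _) (Real.rpow_nonneg (hd x) _)
    split_ifs
    · exact le_rfl
    · exact Set.indicator_nonneg (fun _ _ => shadowAverage_nonneg T u t) _
  refine (Real.rpow_le_rpow hX0 hXr (by positivity)).trans (le_of_eq ?_)
  rw [Real.mul_rpow (by positivity) hY, Real.mul_rpow hC0.le (by positivity),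
    ← Real.rpow_mul (by positivity), mul_one_div_cancel hq0.ne', Real.rpow_one]

end
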